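/- For every fixed r ∈ ℕ, √(2π) · |λ|^{3r} · A(3r + 1/2, λ) → 1 as λ → −∞. -/

import Mathlib

open Filter Real

/-- `A(y,λ) = e^{-λ³/6} 3^{-(y+1)/3} ∑_{k≥0} (3^{2/3}λ/2)^k / (k! Γ((y+1-2k)/3))`,
where `1/Γ` is extended by `0` at the poles (Mathlib's `Real.Gamma` vanishes at
nonpositive integers, so its inverse is `0` there). -/
noncomputable def Afun (y lam : ℝ) : ℝ :=
  Real.exp (-lam ^ 3 / 6) * (3 : ℝ) ^ (-((y + 1) / 3)) *
    ∑' k : ℕ, (((3 : ℝ) ^ ((2 : ℝ) / 3) * lam / 2) ^ k / (k.factorial : ℝ)) *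
      (Real.Gamma ((y + 1 - 2 * k) / 3))⁻¹

section

open MeasureTheory Set
open scoped ComplexConjugate Topology

theorem norm_cpow_ofReal_le_exp {b : ℝ} (hb : 0 ≤ b) (s : ℂ) :
    ‖s ^ (b : ℂ)‖ ≤ rexp (b * ‖s‖) := by
  have h := Complex.norm_cpow_le s b
  simp only [Complex.ofReal_re, Complex.ofReal_im, mul_zero, Real.exp_zero, div_one] at h
  refine h.trans ?_
  rw [mul_comm, Real.exp_mul]
  exact Real.rpow_le_rpow (norm_nonneg _) (by linarith [Real.add_one_le_exp ‖s‖]) hb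

theorem norm_cpow_ofReal_le_exp_of_le_norm (b : ℝ) {c : ℝ} (hc : 0 < c) {s : ℂ} (hs : c ≤ ‖s‖) :
    ‖s ^ (b : ℂ)‖ ≤ rexp (|b| * (‖s‖ + c⁻¹)) := by
  have hpos : 0 < ‖s‖ := hc.trans_le hs
  have h := Complex.norm_cpow_le s b
  simp only [Complex.ofReal_re, Complex.ofReal_im, mul_zero, Real.exp_zero, div_one] at h
  refine h.trans ?_
  rw [Real.rpow_def_of_pos hpos, Real.exp_le_exp]
  have h1 : Real.log ‖s‖ ≤ ‖s‖ := Real.log_le_self hpos.le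
  have h2 : -Real.log ‖s‖ ≤ ‖s‖⁻¹ := by
    rw [← Real.log_inv]; exact Real.log_le_self (inv_nonneg.2 hpos.le)
  have h3 : ‖s‖⁻¹ ≤ c⁻¹ := inv_anti₀ hc hs
  have h4 : |Real.log ‖s‖| ≤ ‖s‖ + c⁻¹ := by
    rw [abs_le]
    constructor
    · linarith
    · linarith [inv_pos.2 hc]
  calc Real.log ‖s‖ * b ≤ |Real.log ‖s‖ * b| := le_abs_self _
    _ = |b| * |Real.log ‖s‖| := by rw [abs_mul, mul_comm]
    _ ≤ _ := by gcongr

theorem integrable_exp_add_abs_sub_sq (K L : ℝ) {d : ℝ} (hd : 0 < d) :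
    Integrable (fun t : ℝ => rexp (K + L * |t| - d * t ^ 2)) := by
  have h := (integrable_exp_neg_mul_sq (half_pos hd)).const_mul (rexp (K + L ^ 2 / (2 * d)))
  refine h.mono' (by fun_prop) (ae_of_all _ fun t => ?_)
  rw [Real.norm_eq_abs, Real.abs_exp, ← Real.exp_add, Real.exp_le_exp]
  have h1 : L * |t| ≤ d / 2 * t ^ 2 + L ^ 2 / (2 * d) := by
    have h2 : d / 2 * t ^ 2 + L ^ 2 / (2 * d) - L * |t| = (d * |t| - L) ^ 2 / (2 * d) := by
      field_simp
      rw [← sq_abs t]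
      ring
    have h3 : 0 ≤ (d * |t| - L) ^ 2 / (2 * d) := by positivity
    linarith
  linarith

/-- The Airy-type integrand `s ^ b * exp (s ^ 3 / 3)`. -/
noncomputable def airyKernel (b : ℝ) (s : ℂ) : ℂ := s ^ (b : ℂ) * Complex.exp (s ^ 3 / 3)

theorem measurable_airyKernel (b : ℝ) : Measurable (airyKernel b) := by
  unfold airyKernel; fun_prop

theorem hasDerivAt_airyKernel (b : ℝ) {s : ℂ} (hs : s ∈ Complex.slitPlane) :
    HasDerivAt (airyKernel b) (b * airyKernel (b - 1) s + airyKernel (b + 2) s) s := by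
  have h0 : s ≠ 0 := Complex.slitPlane_ne_zero hs
  have h1 : HasDerivAt (fun s : ℂ => s ^ (b : ℂ)) (b * s ^ ((b : ℂ) - 1) * 1) s :=
    (hasDerivAt_id s).cpow_const hs
  have h2 : HasDerivAt (fun s : ℂ => Complex.exp (s ^ 3 / 3))
      (Complex.exp (s ^ 3 / 3) * (s ^ 2)) s := by
    refine (((hasDerivAt_id s).pow 3).div_const 3).cexp.congr_deriv ?_
    simp
  refine (h1.mul h2).congr_deriv ?_
  simp only [airyKernel]
  push_cast
  have h3 : s ^ ((b : ℂ) + 2) = s ^ (b : ℂ) * s ^ 2 := by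
    rw [Complex.cpow_add _ _ h0]; norm_cast
  rw [h3]
  ring

theorem airyKernel_conj (b : ℝ) {s : ℂ} (hs : s ∈ Complex.slitPlane) :
    airyKernel b (conj s) = conj (airyKernel b s) := by
  have h := Complex.conj_cpow s b (Complex.mem_slitPlane_iff_arg.1 hs).1
  simp only [airyKernel, map_mul, ← Complex.exp_conj]
  rw [h]
  simp [map_div₀, Complex.conj_ofNat]

theorem norm_airyKernel_le {b : ℝ} (hb : 0 ≤ b) (s : ℂ) :
    ‖airyKernel b s‖ ≤ rexp (b * ‖s‖ + (s ^ 3).re / 3) := by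
  rw [airyKernel, norm_mul, Complex.norm_exp, Real.exp_add]
  have h : (s ^ 3 / 3).re = (s ^ 3).re / 3 := by
    rw [show (3 : ℂ) = ((3 : ℝ) : ℂ) by norm_num, Complex.div_ofReal_re]
  rw [h]
  gcongr
  exact norm_cpow_ofReal_le_exp hb s

theorem norm_add_I_mul_le (c t : ℝ) (hc : 0 ≤ c) : ‖(c : ℂ) + Complex.I * t‖ ≤ c + |t| := by
  refine (norm_add_le _ _).trans ?_
  simp [abs_of_nonneg hc]

theorem le_norm_add_I_mul (c t : ℝ) : c ≤ ‖(c : ℂ) + Complex.I * t‖ := by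
  have := Complex.re_le_norm ((c : ℂ) + Complex.I * t)
  simpa using this

theorem norm_airyKernel_vertical_le (b : ℝ) {c : ℝ} (hc : 0 < c) (t : ℝ) :
    ‖airyKernel b (c + Complex.I * t)‖ ≤
      rexp ((|b| * (c + c⁻¹) + c ^ 3 / 3) + |b| * |t| - c * t ^ 2) := by
  rw [airyKernel, norm_mul, Complex.norm_exp]
  have h : (((c : ℂ) + Complex.I * t) ^ 3 / 3).re = c ^ 3 / 3 - c * t ^ 2 := by
    rw [show (3 : ℂ) = ((3 : ℝ) : ℂ) by norm_num, Complex.div_ofReal_re]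
    simp [pow_succ]
    ring
  have h1 := norm_cpow_ofReal_le_exp_of_le_norm b hc (le_norm_add_I_mul c t)
  have h2 := norm_add_I_mul_le c t hc.le
  rw [h]
  calc _ ≤ rexp (|b| * (c + |t| + c⁻¹)) * rexp (c ^ 3 / 3 - c * t ^ 2) := by
        gcongr
        refine h1.trans ?_
        gcongr
    _ = _ := by rw [← Real.exp_add]; ring_nf

theorem integrable_airyKernel_vertical (b : ℝ) {c : ℝ} (hc : 0 < c) :
    Integrable (fun t : ℝ => airyKernel b (c + Complex.I * t)) :=
  (integrable_exp_add_abs_sub_sq _ _ hc).mono'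
    ((measurable_airyKernel b).comp (by fun_prop)).aestronglyMeasurable
    (ae_of_all _ (norm_airyKernel_vertical_le b hc))

theorem add_I_mul_mem_slitPlane {c : ℝ} (hc : 0 < c) (t : ℝ) :
    (c : ℂ) + Complex.I * t ∈ Complex.slitPlane := by
  left; simpa using hc

theorem integral_airyKernel_vertical_rec (b : ℝ) {c : ℝ} (hc : 0 < c) :
    b * (∫ t : ℝ, airyKernel (b - 1) (c + Complex.I * t)) +
      ∫ t : ℝ, airyKernel (b + 2) (c + Complex.I * t) = 0 := by
  have hd : ∀ t : ℝ, HasDerivAt (fun t : ℝ => airyKernel b (c + Complex.I * t))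
      ((b * airyKernel (b - 1) (c + Complex.I * t) + airyKernel (b + 2) (c + Complex.I * t)) *
        Complex.I) t := by
    intro t
    have h1 : HasDerivAt (fun t : ℝ => (c : ℂ) + Complex.I * t) Complex.I t := by
      simpa using ((Complex.ofRealCLM.hasDerivAt (x := t)).const_mul Complex.I).const_add (c : ℂ)
    exact (hasDerivAt_airyKernel b (add_I_mul_mem_slitPlane hc t)).comp t h1
  have hi1 := (integrable_airyKernel_vertical (b - 1) hc).const_mul (b : ℂ)
  have hi2 := integrable_airyKernel_vertical (b + 2) hc
  have h := integral_eq_zero_of_hasDerivAt_of_integrable hd ((hi1.add hi2).mul_const _)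
    (integrable_airyKernel_vertical b hc)
  rw [integral_mul_const, integral_add hi1 hi2, integral_const_mul] at h
  simpa using h

/-- The ray starting at `(1 - τ) * c` with direction `τ + √3 * I`. -/
noncomputable def airyPath (c τ t : ℝ) : ℂ :=
  ((1 - τ : ℝ) : ℂ) * c + ((τ : ℂ) + √3 * Complex.I) * t

theorem airyPath_re (c τ t : ℝ) : (airyPath c τ t).re = (1 - τ) * c + τ * t := by
  simp [airyPath]

theorem airyPath_im (c τ t : ℝ) : (airyPath c τ t).im = √3 * t := by
  simp [airyPath]

theorem airyPath_mem_slitPlane (c τ : ℝ) {t : ℝ} (ht : 0 < t) :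
    airyPath c τ t ∈ Complex.slitPlane := by
  right
  rw [airyPath_im]
  positivity

theorem norm_airyPath_le {c τ t : ℝ} (hc : 0 ≤ c) (hτ : τ ∈ Icc (0 : ℝ) 1) (ht : 0 ≤ t) :
    ‖airyPath c τ t‖ ≤ c + 3 * t := by
  have h3 : √3 ≤ 2 := by rw [Real.sqrt_le_left] <;> norm_num
  have h := Complex.norm_le_abs_re_add_abs_im (airyPath c τ t)
  rw [airyPath_re, airyPath_im] at h
  have h1 : 0 ≤ (1 - τ) * c + τ * t :=
    add_nonneg (mul_nonneg (by linarith [hτ.2]) hc) (mul_nonneg hτ.1 ht)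
  rw [abs_of_nonneg h1, abs_of_nonneg (by positivity)] at h
  nlinarith [mul_nonneg hτ.1 hc, mul_nonneg (sub_nonneg.2 hτ.2) ht, mul_le_mul_of_nonneg_right h3 ht]

theorem airyPath_cube_re_le {c τ t : ℝ} (hc : 0 < c) (hτ : τ ∈ Icc (0 : ℝ) 1) (ht : 0 ≤ t) :
    ((airyPath c τ t) ^ 3).re ≤ 2 * c ^ 2 * (c + t) - 7 * min c 1 * (t ^ 2 - 1) := by
  have h3 : √3 ^ 2 = 3 := Real.sq_sqrt (by norm_num)
  obtain ⟨h0, h1⟩ := hτ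
  have hτ' : 0 ≤ 1 - τ := by linarith
  set m := min c 1 with hm
  have hm0 : 0 < m := lt_min hc one_pos
  have hmc : m ≤ c := min_le_left _ _
  have hm1 : m ≤ 1 := min_le_right _ _
  set x := (1 - τ) * c + τ * t with hx
  have hre : ((airyPath c τ t) ^ 3).re = x * (x ^ 2 - 9 * t ^ 2) := by
    have e1 := airyPath_re c τ t
    have e2 := airyPath_im c τ t
    rw [← hx] at e1
    have : ((airyPath c τ t) ^ 3).re = (airyPath c τ t).re ^ 3 -
        3 * (airyPath c τ t).re * (airyPath c τ t).im ^ 2 := by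
      simp [pow_succ]; ring
    rw [this, e1, e2, mul_pow, h3]
    ring
  have hx0 : 0 ≤ x := by positivity
  have hxle : x ≤ c + t := by
    nlinarith [mul_nonneg h0 hc.le, mul_nonneg hτ' ht]
  have hx2 : x ^ 2 ≤ 2 * c ^ 2 + 2 * t ^ 2 := by nlinarith [sq_nonneg (c - t)]
  have hxm : m * (1 - τ + τ * t) ≤ x := by
    have a1 := mul_le_mul_of_nonneg_left hmc hτ'
    have a2 := mul_le_mul_of_nonneg_right hm1 (mul_nonneg h0 ht)
    nlinarith
  have hcub : t ^ 2 - 1 ≤ t ^ 2 * (1 - τ + τ * t) := by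
    have : t ^ 2 * (1 - t) ≤ 1 := by
      rcases le_total t 1 with h | h
      · nlinarith
      · nlinarith [mul_nonneg (sq_nonneg t) (sub_nonneg.2 h)]
    nlinarith [mul_le_mul_of_nonneg_left this h0]
  have hxt : m * (t ^ 2 - 1) ≤ x * t ^ 2 := by
    have a1 := mul_le_mul_of_nonneg_left hcub hm0.le
    have a2 := mul_le_mul_of_nonneg_right hxm (sq_nonneg t)
    nlinarith
  rw [hre]
  have a3 : x * (x ^ 2 - 9 * t ^ 2) ≤ x * (2 * c ^ 2 - 7 * t ^ 2) :=
    mul_le_mul_of_nonneg_left (by linarith) hx0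
  have a4 : x * (2 * c ^ 2) ≤ (c + t) * (2 * c ^ 2) :=
    mul_le_mul_of_nonneg_right hxle (by positivity)
  linarith

theorem exists_integrable_bound_airyPath {b c : ℝ} (hb : 0 ≤ b) (hc : 0 < c) :
    ∃ g : ℝ → ℝ, Integrable g ∧ ∀ τ ∈ Icc (0 : ℝ) 1, ∀ t, 0 ≤ t →
      (1 + (c + t)) * ‖airyKernel b (airyPath c τ t)‖ ≤ g t := by
  have hm0 : 0 < min c 1 := lt_min hc one_pos
  refine ⟨_, integrable_exp_add_abs_sub_sq (c + b * c + (2 * c ^ 3 + 7 * min c 1) / 3)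
    (1 + 3 * b + 2 * c ^ 2 / 3) (d := 7 * min c 1 / 3) (by positivity), fun τ hτ t ht => ?_⟩
  have h1 := norm_airyKernel_le hb (airyPath c τ t)
  have h2 := airyPath_cube_re_le hc hτ ht
  have h3 := mul_le_mul_of_nonneg_left (norm_airyPath_le hc.le hτ ht) hb
  calc _ ≤ rexp (c + t) * rexp (b * ‖airyPath c τ t‖ + ((airyPath c τ t) ^ 3).re / 3) := by
        gcongr
        linarith [Real.add_one_le_exp (c + t)]
    _ ≤ _ := by
        rw [← Real.exp_add, Real.exp_le_exp, abs_of_nonneg ht]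
        linarith

@[fun_prop]
theorem continuous_airyPath (c τ : ℝ) : Continuous (airyPath c τ) := by
  unfold airyPath; fun_prop

theorem hasDerivAt_airyPath (c τ t : ℝ) :
    HasDerivAt (airyPath c τ) ((τ : ℂ) + √3 * Complex.I) t := by
  have := ((Complex.ofRealCLM.hasDerivAt (x := t)).const_mul
    ((τ : ℂ) + √3 * Complex.I)).const_add (((1 - τ : ℝ) : ℂ) * c)
  exact this.congr_deriv (by simp)

theorem hasDerivAt_airyPath_left (c τ t : ℝ) :
    HasDerivAt (fun τ => airyPath c τ t) ((t : ℂ) - c) τ := by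
  have h1 := Complex.ofRealCLM.hasDerivAt (x := τ)
  have := ((h1.const_sub 1).mul_const (c : ℂ)).add
    ((h1.add_const ((√3 : ℂ) * Complex.I)).mul_const (t : ℂ))
  refine (this.congr_deriv ?_).congr_of_eventuallyEq (Eventually.of_forall fun x => ?_)
  · simp; ring
  · simp [airyPath]

theorem norm_direction_le {τ : ℝ} (hτ : τ ∈ Icc (0 : ℝ) 1) : ‖(τ : ℂ) + √3 * Complex.I‖ ≤ 3 := by
  have h3 : √3 ≤ 2 := by rw [Real.sqrt_le_left] <;> norm_num
  refine (norm_add_le _ _).trans ?_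
  simp [abs_of_nonneg hτ.1, abs_of_nonneg (Real.sqrt_nonneg 3)]
  linarith [hτ.2]

/-- The integral of `airyKernel b` along `airyPath c τ`. -/
noncomputable def airyRay (b c τ : ℝ) : ℂ :=
  ∫ t in Ioi (0 : ℝ), airyKernel b (airyPath c τ t) * ((τ : ℂ) + √3 * Complex.I)

theorem measurable_airyKernel_airyPath (b c τ : ℝ) :
    Measurable (fun t => airyKernel b (airyPath c τ t)) :=
  (measurable_airyKernel b).comp (by fun_prop)

theorem norm_airyKernel_airyPath_le {b c τ t y : ℝ} (hc : 0 < c) (ht : 0 ≤ t)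
    (h : (1 + (c + t)) * ‖airyKernel b (airyPath c τ t)‖ ≤ y) :
    ‖airyKernel b (airyPath c τ t)‖ ≤ y ∧
      ‖airyKernel b (airyPath c τ t)‖ * ‖(t : ℂ) - c‖ ≤ y := by
  have h1 : ‖(t : ℂ) - c‖ ≤ c + t := by
    refine (norm_sub_le _ _).trans ?_
    simp [abs_of_nonneg ht, abs_of_pos hc, add_comm]
  have h2 := norm_nonneg (airyKernel b (airyPath c τ t))
  have h3 : 0 ≤ (c + t) * ‖airyKernel b (airyPath c τ t)‖ := by positivity
  constructor
  · linarith
  · have := mul_le_mul_of_nonneg_left h1 h2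
    linarith

theorem continuousOn_airyRay {b c : ℝ} (hb : 0 ≤ b) (hc : 0 < c) :
    ContinuousOn (airyRay b c) (Icc 0 1) := by
  obtain ⟨g, hg, hbound⟩ := exists_integrable_bound_airyPath hb hc
  refine continuousOn_of_dominated (bound := fun t => g t * 3) (fun τ hτ => ?_) (fun τ hτ => ?_)
    (hg.mul_const 3).integrableOn ?_
  · exact ((measurable_airyKernel_airyPath b c τ).mul_const _).aestronglyMeasurable
  · refine (ae_restrict_iff' measurableSet_Ioi).2 (ae_of_all _ fun t ht => ?_)
    have h := (norm_airyKernel_airyPath_le hc (le_of_lt ht) (hbound τ hτ t (le_of_lt ht))).1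
    rw [norm_mul]
    exact mul_le_mul h (norm_direction_le hτ) (norm_nonneg _) ((norm_nonneg _).trans h)
  · refine (ae_restrict_iff' measurableSet_Ioi).2 (ae_of_all _ fun t ht τ hτ => ?_)
    have h1 := (hasDerivAt_airyKernel b (airyPath_mem_slitPlane c τ ht)).continuousAt
    have h2 : ContinuousAt (fun τ => airyKernel b (airyPath c τ t)) τ :=
      ContinuousAt.comp (f := fun τ => airyPath c τ t) h1
        (hasDerivAt_airyPath_left c τ t).continuousAt
    exact (h2.mul (by fun_prop)).continuousWithinAt

theorem hasDerivAt_airyRay {b c τ : ℝ} (hb : 1 ≤ b) (hc : 0 < c) (hτ : τ ∈ Ioo (0 : ℝ) 1) :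
    HasDerivAt (airyRay b c) (airyKernel b (airyPath c τ 0) * c) τ := by
  obtain ⟨g, hg, hbound⟩ := exists_integrable_bound_airyPath (b := b) (by linarith) hc
  obtain ⟨g₁, hg₁, hbound₁⟩ := exists_integrable_bound_airyPath (b := b - 1) (by linarith) hc
  obtain ⟨g₂, hg₂, hbound₂⟩ := exists_integrable_bound_airyPath (b := b + 2) (by linarith) hc
  have hm := measurable_airyKernel_airyPath
  have hIcc : Ioo (0 : ℝ) 1 ⊆ Icc 0 1 := Ioo_subset_Icc_self
  let F' : ℝ → ℝ → ℂ := fun τ t =>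
    (b * airyKernel (b - 1) (airyPath c τ t) + airyKernel (b + 2) (airyPath c τ t)) *
      ((t : ℂ) - c) * ((τ : ℂ) + √3 * Complex.I) + airyKernel b (airyPath c τ t)
  have hmF' : AEStronglyMeasurable (F' τ) (volume.restrict (Ioi 0)) :=
    (((((hm (b - 1) c τ).const_mul _).add (hm (b + 2) c τ)).mul (by fun_prop)).mul_const _
      |>.add (hm b c τ)).aestronglyMeasurable
  have hbF : ∀ τ ∈ Ioo (0 : ℝ) 1, ∀ t ∈ Ioi (0 : ℝ), ‖airyKernel b (airyPath c τ t)‖ ≤ g t :=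
    fun τ hτ t ht =>
      (norm_airyKernel_airyPath_le hc (le_of_lt ht) (hbound τ (hIcc hτ) t (le_of_lt ht))).1
  have hbF' : ∀ t ∈ Ioi (0 : ℝ), ∀ τ ∈ Ioo (0 : ℝ) 1,
      ‖F' τ t‖ ≤ (b * g₁ t + g₂ t) * 3 + g t := by
    intro t ht τ hτ
    have ht' : (0 : ℝ) ≤ t := le_of_lt ht
    have h1 := (norm_airyKernel_airyPath_le hc ht' (hbound₁ τ (hIcc hτ) t ht')).2
    have h2 := (norm_airyKernel_airyPath_le hc ht' (hbound₂ τ (hIcc hτ) t ht')).2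
    have h3 := hbF τ hτ t ht
    refine (norm_add_le _ _).trans (add_le_add ?_ h3)
    rw [norm_mul]
    have h4 : ‖(b * airyKernel (b - 1) (airyPath c τ t) + airyKernel (b + 2) (airyPath c τ t)) *
      ((t : ℂ) - c)‖ ≤ b * g₁ t + g₂ t := by
      rw [add_mul]
      refine (norm_add_le _ _).trans (add_le_add ?_ ?_)
      · rw [mul_assoc, norm_mul, norm_mul, Complex.norm_real, Real.norm_of_nonneg (by linarith)]
        gcongr
      · rw [norm_mul]; exact h2
    exact mul_le_mul h4 (norm_direction_le (hIcc hτ)) (norm_nonneg _) ((norm_nonneg _).trans h4)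
  have hgi : Integrable (fun t => (b * g₁ t + g₂ t) * 3 + g t) (volume.restrict (Ioi 0)) :=
    ((((hg₁.const_mul b).add hg₂).mul_const 3).add hg).integrableOn
  have key := hasDerivAt_integral_of_dominated_loc_of_deriv_le (μ := volume.restrict (Ioi (0 : ℝ)))
    (F := fun τ t => airyKernel b (airyPath c τ t) * ((τ : ℂ) + √3 * Complex.I)) (F' := F')
    (x₀ := τ) (bound := fun t => (b * g₁ t + g₂ t) * 3 + g t) (Ioo_mem_nhds hτ.1 hτ.2)
    (Eventually.of_forall fun τ => ((hm b c τ).mul_const _).aestronglyMeasurable) ?_ hmF'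
    ((ae_restrict_iff' measurableSet_Ioi).2 (ae_of_all _ hbF')) hgi ?_
  · obtain ⟨hint, hderiv⟩ := key
    have hpath : ∀ t : ℝ, airyPath c τ t ∈ Complex.slitPlane →
        HasDerivAt (fun t : ℝ => airyKernel b (airyPath c τ t) * ((t : ℂ) - c)) (F' τ t) t := by
      intro t ht
      have h1 := (hasDerivAt_airyKernel b ht).comp t (hasDerivAt_airyPath c τ t)
      have h2 : HasDerivAt (fun t : ℝ => (t : ℂ) - c) 1 t := by
        simpa using (Complex.ofRealCLM.hasDerivAt (x := t)).sub_const (c : ℂ)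
      refine (h1.mul h2).congr_deriv ?_
      simp only [F', Function.comp]
      ring
    have hint0 : IntegrableOn (fun t : ℝ => airyKernel b (airyPath c τ t) * ((t : ℂ) - c))
        (Ioi 0) := by
      refine hg.integrableOn.mono' ((hm b c τ).mul (by fun_prop)).aestronglyMeasurable
        ((ae_restrict_iff' measurableSet_Ioi).2 (ae_of_all _ fun t ht => ?_))
      rw [norm_mul]
      exact (norm_airyKernel_airyPath_le hc (le_of_lt ht)
        (hbound τ (hIcc hτ) t (le_of_lt ht))).2
    have hd : ∀ t ∈ Ioi (0 : ℝ),
        HasDerivAt (fun t : ℝ => airyKernel b (airyPath c τ t) * ((t : ℂ) - c)) (F' τ t) t :=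
      fun t ht => hpath t (airyPath_mem_slitPlane c τ ht)
    have hd0 := hpath 0 (by
      left
      rw [airyPath_re]
      simpa using mul_pos (sub_pos.2 hτ.2) hc)
    have htend := tendsto_zero_of_hasDerivAt_of_integrableOn_Ioi hd hint hint0
    have hval := integral_Ioi_of_hasDerivAt_of_tendsto
      hd0.continuousAt.continuousWithinAt hd hint htend
    refine hderiv.congr_deriv (hval.trans ?_)
    simp
  · refine (hg.mul_const 3).integrableOn.mono' ((hm b c τ).mul_const _).aestronglyMeasurable
      ((ae_restrict_iff' measurableSet_Ioi).2 (ae_of_all _ fun t ht => ?_))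
    have h := hbF τ hτ t ht
    rw [norm_mul]
    exact mul_le_mul h (norm_direction_le (hIcc hτ)) (norm_nonneg _) ((norm_nonneg _).trans h)
  · refine (ae_restrict_iff' measurableSet_Ioi).2 (ae_of_all _ fun t ht τ hτ => ?_)
    have h1 := (hasDerivAt_airyKernel b (airyPath_mem_slitPlane c τ ht)).comp τ
      (hasDerivAt_airyPath_left c τ t)
    have h2 : HasDerivAt (fun τ : ℝ => (τ : ℂ) + √3 * Complex.I) 1 τ := by
      simpa using (Complex.ofRealCLM.hasDerivAt (x := τ)).add_const ((√3 : ℂ) * Complex.I)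
    refine (h1.mul h2).congr_deriv ?_
    simp only [F', Function.comp]
    ring

theorem airyRay_im_eq {b c : ℝ} (hb : 1 ≤ b) (hc : 0 < c) :
    (airyRay b c 0).im = (airyRay b c 1).im := by
  obtain ⟨τ, hτ, h⟩ := exists_hasDerivAt_eq_slope (fun τ => (airyRay b c τ).im) _ zero_lt_one
    (Complex.continuous_im.comp_continuousOn (continuousOn_airyRay (by linarith) hc))
    (fun τ hτ => Complex.imCLM.hasFDerivAt.comp_hasDerivAt τ (hasDerivAt_airyRay hb hc hτ))
  have hre : (airyKernel b (airyPath c τ 0) * c).im = 0 := by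
    have hs : airyPath c τ 0 ∈ Complex.slitPlane := by
      left
      rw [airyPath_re]
      simpa using mul_pos (sub_pos.2 hτ.2) hc
    have h1 := airyKernel_conj b hs
    have h2 : conj (airyPath c τ 0) = airyPath c τ 0 := by simp [airyPath]
    rw [h2] at h1
    have h3 := Complex.conj_eq_iff_im.1 h1.symm
    simp [Complex.mul_im, h3]
  simp only [Complex.imCLM_apply, hre] at h
  linarith

theorem airyRay_zero (b c : ℝ) :
    airyRay b c 0 = Complex.I * ∫ t in Ioi (0 : ℝ), airyKernel b (c + Complex.I * t) := by
  have h := integral_comp_mul_left_Ioi (fun t : ℝ => airyKernel b (c + Complex.I * t)) 0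
    (show (0 : ℝ) < √3 by positivity)
  have h3 : (√3 : ℂ) ≠ 0 := by
    have : √3 ≠ 0 := by positivity
    exact_mod_cast this
  rw [mul_zero] at h
  rw [airyRay, integral_mul_const]
  have h1 : ∀ t : ℝ, airyPath c 0 t = c + Complex.I * ((√3 * t : ℝ) : ℂ) := by
    intro t
    simp [airyPath]
    ring
  simp_rw [h1]
  rw [h, Complex.real_smul]
  push_cast
  field_simp
  ring

theorem integral_airyKernel_vertical_eq_airyRay (b : ℝ) {c : ℝ} (hc : 0 < c) :
    ∫ t : ℝ, airyKernel b (c + Complex.I * t) = ((2 * (airyRay b c 0).im : ℝ) : ℂ) := by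
  have hi := integrable_airyKernel_vertical b hc
  have h1 := intervalIntegral.integral_Iic_add_Ioi (b := (0 : ℝ)) hi.integrableOn hi.integrableOn
  have h2 := integral_comp_neg_Iic 0 (fun t : ℝ => airyKernel b (c + Complex.I * ((-t : ℝ) : ℂ)))
  have h3 : ∀ t : ℝ, airyKernel b (c + Complex.I * ((-t : ℝ) : ℂ)) =
      conj (airyKernel b (c + Complex.I * t)) := by
    intro t
    rw [← airyKernel_conj b (add_I_mul_mem_slitPlane hc t)]
    simp
  simp only [neg_neg, neg_zero] at h2
  simp_rw [h3] at h2
  rw [integral_conj] at h2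
  rw [← h1, h2, airyRay_zero, add_comm, Complex.add_conj]
  simp

theorem one_add_sqrt_three_mul_I_cpow (z : ℂ) :
    ((1 : ℂ) + √3 * Complex.I) ^ z = Complex.exp ((Real.log 2 + π / 3 * Complex.I) * z) := by
  have hw : (1 : ℂ) + √3 * Complex.I = Complex.exp (Real.log 2 + π / 3 * Complex.I) := by
    rw [Complex.exp_add, ← Complex.ofReal_exp, Real.exp_log two_pos, Complex.exp_mul_I]
    have e1 : Complex.cos (π / 3) = ((1 / 2 : ℝ) : ℂ) := by
      rw [← Real.cos_pi_div_three]; push_cast; rfl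
    have e2 : Complex.sin (π / 3) = ((√3 / 2 : ℝ) : ℂ) := by
      rw [← Real.sin_pi_div_three]; push_cast; rfl
    rw [e1, e2]
    push_cast
    ring
  have him : ((Real.log 2 : ℂ) + π / 3 * Complex.I).im = π / 3 := by
    have : ((Real.log 2 : ℂ) + π / 3 * Complex.I) =
      ((Real.log 2 : ℝ) : ℂ) + ((π / 3 : ℝ) : ℂ) * Complex.I := by push_cast; rfl
    rw [this, Complex.add_im, Complex.ofReal_im, Complex.im_ofReal_mul, Complex.I_im]
    ring
  rw [Complex.cpow_def_of_ne_zero (by rw [hw]; exact Complex.exp_ne_zero _), hw,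
    Complex.log_exp (by rw [him]; linarith [Real.pi_pos]) (by rw [him]; linarith [Real.pi_pos])]

theorem ofReal_mul_cpow {t : ℝ} (ht : 0 < t) {w : ℂ} (hw : w ≠ 0) (z : ℂ) :
    ((t : ℂ) * w) ^ z = (t : ℂ) ^ z * w ^ z := by
  have ht0 : (t : ℂ) ≠ 0 := by exact_mod_cast ht.ne'
  rw [Complex.cpow_def_of_ne_zero (mul_ne_zero ht0 hw), Complex.cpow_def_of_ne_zero ht0,
    Complex.cpow_def_of_ne_zero hw, Complex.log_ofReal_mul ht hw, ← Complex.exp_add,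
    Complex.ofReal_log ht.le, add_mul]

theorem airyRay_one_im {b : ℝ} (hb : 0 ≤ b) (c : ℝ) :
    (airyRay b c 1).im = (3 : ℝ) ^ ((b - 2) / 3) * Real.Gamma ((b + 1) / 3) *
      Real.sin (π * ((b + 1) / 3)) := by
  have hw0 : (1 : ℂ) + √3 * Complex.I ≠ 0 := by
    intro h
    simpa using congrArg Complex.re h
  have hcube : ((1 : ℂ) + √3 * Complex.I) ^ 3 = -8 := by
    have h3 : (√3 : ℂ) ^ 2 = 3 := by
      have : √3 ^ 2 = 3 := Real.sq_sqrt (by norm_num)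
      exact_mod_cast this
    have hI := Complex.I_sq
    calc ((1 : ℂ) + √3 * Complex.I) ^ 3 = 1 + 3 * √3 * Complex.I + 3 * √3 ^ 2 * Complex.I ^ 2 +
          √3 ^ 2 * √3 * Complex.I ^ 2 * Complex.I := by ring
      _ = -8 := by rw [h3, hI]; ring
  have hint : airyRay b c 1 = ∫ t in Ioi (0 : ℝ),
      ((t ^ b * rexp (-(8 / 3) * t ^ (3 : ℝ)) : ℝ) : ℂ) *
        ((1 : ℂ) + √3 * Complex.I) ^ ((b : ℂ) + 1) := by
    refine setIntegral_congr_fun measurableSet_Ioi fun t ht => ?_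
    have ht' : (0 : ℝ) < t := ht
    have hp : airyPath c 1 t = (t : ℂ) * (1 + √3 * Complex.I) := by
      simp [airyPath]; ring
    rw [hp, airyKernel, ofReal_mul_cpow ht' hw0, mul_pow, hcube, Complex.cpow_add _ _ hw0, Complex.cpow_one]
    push_cast
    rw [Complex.ofReal_cpow ht'.le, show t ^ (3 : ℝ) = t ^ 3 by norm_cast]
    push_cast
    rw [show (t : ℂ) ^ 3 * -8 / 3 = -(8 / 3) * t ^ 3 by ring]
    ring
  have hval := integral_rpow_mul_exp_neg_mul_rpow (p := 3) (q := b) (b := 8 / 3) (by norm_num)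
    (by linarith) (by norm_num)
  have hz : ((Real.log 2 : ℝ) + π / 3 * Complex.I) * ((b : ℂ) + 1) =
      ((Real.log 2 * (b + 1) : ℝ) : ℂ) + ((π * ((b + 1) / 3) : ℝ) : ℂ) * Complex.I := by
    push_cast
    ring
  have hpow : (8 / 3 : ℝ) ^ (-(b + 1) / 3) * (1 / 3) * rexp (Real.log 2 * (b + 1)) =
      (3 : ℝ) ^ ((b - 2) / 3) := by
    have h8 : Real.log (8 / 3) = 3 * Real.log 2 - Real.log 3 := by
      rw [Real.log_div (by norm_num) (by norm_num), show (8 : ℝ) = 2 ^ 3 by norm_num, Real.log_pow]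
      norm_num
    have h3 : (1 / 3 : ℝ) = rexp (-Real.log 3) := by
      rw [Real.exp_neg, Real.exp_log (by norm_num)]; norm_num
    rw [Real.rpow_def_of_pos (by norm_num), Real.rpow_def_of_pos (by norm_num), h8, h3,
      ← Real.exp_add, ← Real.exp_add]
    congr 1
    ring
  rw [hint, integral_mul_const, integral_complex_ofReal, hval, Complex.im_ofReal_mul,
    one_add_sqrt_three_mul_I_cpow, hz, Complex.exp_add, ← Complex.ofReal_exp,
    Complex.im_ofReal_mul, Complex.exp_ofReal_mul_I_im, ← hpow]
  ring

theorem integral_airyKernel_vertical_of_one_le {b c : ℝ} (hb : 1 ≤ b) (hc : 0 < c) :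
    ∫ t : ℝ, airyKernel b (c + Complex.I * t) =
      ((2 * π * ((3 : ℝ) ^ ((b - 2) / 3) * (Real.Gamma ((2 - b) / 3))⁻¹) : ℝ) : ℂ) := by
  rw [integral_airyKernel_vertical_eq_airyRay b hc, airyRay_im_eq hb hc,
    airyRay_one_im (by linarith) c]
  have hG : 0 < Real.Gamma ((b + 1) / 3) := Real.Gamma_pos_of_pos (by linarith)
  have h := Real.Gamma_mul_Gamma_one_sub ((b + 1) / 3)
  rw [show 1 - (b + 1) / 3 = (2 - b) / 3 by ring] at h
  have h2 : (Real.Gamma ((2 - b) / 3))⁻¹ =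
      Real.Gamma ((b + 1) / 3) * Real.sin (π * ((b + 1) / 3)) / π := by
    rw [← inv_inj, inv_inv, inv_div, mul_comm (Real.Gamma _), ← div_div, ← h]
    field_simp
  rw [h2]
  have := Real.pi_ne_zero
  congr 1
  field_simp

theorem integral_airyKernel_vertical {b c : ℝ} (hb : ∀ n : ℕ, b + 1 + 3 * n ≠ 0) (hc : 0 < c) :
    ∫ t : ℝ, airyKernel b (c + Complex.I * t) =
      ((2 * π * ((3 : ℝ) ^ ((b - 2) / 3) * (Real.Gamma ((2 - b) / 3))⁻¹) : ℝ) : ℂ) := by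
  obtain ⟨n, hn⟩ := exists_nat_ge (1 - b)
  replace hn : 1 ≤ b + 3 * n := by
    have : (0 : ℝ) ≤ n := n.cast_nonneg
    linarith
  induction n generalizing b with
  | zero => exact integral_airyKernel_vertical_of_one_le (by simpa using hn) hc
  | succ n ih =>
    have hrec := integral_airyKernel_vertical_rec (b + 1) hc
    rw [show b + 1 - 1 = b by ring, show b + 1 + 2 = b + 3 by ring,
      ih (b := b + 3) (fun m => by have := hb (m + 1); push_cast at this; convert this using 1; ring)
        (by push_cast at hn; linarith)] at hrec
    have hb0 : b + 1 ≠ 0 := by simpa using hb 0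
    have hbc : ((b + 1 : ℝ) : ℂ) ≠ 0 := by exact_mod_cast hb0
    refine mul_left_cancel₀ hbc (eq_of_sub_eq_zero (Eq.trans ?_ hrec))
    rw [sub_eq_add_neg]
    congr 1
    rw [← Complex.ofReal_mul, ← Complex.ofReal_neg]
    congr 1
    have hne : (-1 - b) / 3 ≠ 0 := by
      intro h
      apply hb0
      linarith
    have hG : Real.Gamma ((2 - b) / 3) = (-1 - b) / 3 * Real.Gamma ((-1 - b) / 3) := by
      rw [← Real.Gamma_add_one hne]
      congr 1
      ring
    have hp : (3 : ℝ) ^ ((b + 3 - 2) / 3) = 3 * (3 : ℝ) ^ ((b - 2) / 3) := by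
      rw [show (b + 3 - 2) / 3 = (b - 2) / 3 + 1 by ring, Real.rpow_add_one (by norm_num)]
      ring
    have hinv : (b + 1) * ((-1 - b) / 3)⁻¹ = -3 := by
      have : -1 - b ≠ 0 := fun h => hb0 (by linarith)
      field_simp
      ring
    rw [hG, hp, show (2 - (b + 3)) / 3 = (-1 - b) / 3 by ring, mul_inv]
    linear_combination (-(2 * π * (3 : ℝ) ^ ((b - 2) / 3) * (Real.Gamma ((-1 - b) / 3))⁻¹)) * hinv

theorem norm_sq_add_I_mul (c t : ℝ) : ‖(c : ℂ) + Complex.I * t‖ ^ 2 = c ^ 2 + t ^ 2 := by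
  rw [← Complex.normSq_eq_norm_sq, Complex.normSq_apply]
  simp
  ring

theorem airyKernel_add_two_mul (b : ℝ) (k : ℕ) {s : ℂ} (hs : s ≠ 0) :
    airyKernel (b + 2 * k) s = airyKernel b s * (s ^ 2) ^ k := by
  have h : s ^ ((b : ℂ) + 2 * k) = s ^ (b : ℂ) * (s ^ 2) ^ k := by
    rw [Complex.cpow_add _ _ hs, ← pow_mul]
    norm_cast
  simp only [airyKernel]
  push_cast
  rw [h]
  ring

theorem hasSum_integral_airyKernel (b : ℝ) {m : ℝ} (hm : 0 < m) :
    HasSum (fun k : ℕ => ((-m / 2) ^ k / k.factorial : ℝ) *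
        ∫ t : ℝ, airyKernel (b + 2 * k) (m + Complex.I * t))
      (∫ t : ℝ, airyKernel b (m + Complex.I * t) *
        Complex.exp (-m / 2 * ((m : ℂ) + Complex.I * t) ^ 2)) := by
  have hmeas : ∀ b : ℝ, Measurable (fun t : ℝ => airyKernel b (m + Complex.I * t)) :=
    fun b => (measurable_airyKernel b).comp (by fun_prop)
  have hbsum : ∀ t : ℝ, HasSum
      (fun k : ℕ => ‖airyKernel b (m + Complex.I * t)‖ *
        ((m / 2 * (m ^ 2 + t ^ 2)) ^ k / k.factorial))
      (‖airyKernel b (m + Complex.I * t)‖ * rexp (m / 2 * (m ^ 2 + t ^ 2))) := by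
    intro t
    have h := NormedSpace.expSeries_div_hasSum_exp (m / 2 * (m ^ 2 + t ^ 2))
    rw [← Real.exp_eq_exp_ℝ] at h
    exact h.mul_left _
  have hF : ∀ (k : ℕ) (t : ℝ), ((-m / 2) ^ k / k.factorial : ℝ) *
      airyKernel (b + 2 * k) (m + Complex.I * t) = airyKernel b (m + Complex.I * t) *
        ((-m / 2 * ((m : ℂ) + Complex.I * t) ^ 2) ^ k / k.factorial) := by
    intro k t
    rw [airyKernel_add_two_mul b k (Complex.slitPlane_ne_zero (add_I_mul_mem_slitPlane hm t)),
      mul_pow]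
    push_cast
    ring
  simp_rw [← integral_const_mul]
  refine hasSum_integral_of_dominated_convergence
    (fun k t => ‖airyKernel b (m + Complex.I * t)‖ *
      ((m / 2 * (m ^ 2 + t ^ 2)) ^ k / k.factorial)) (fun k => ?_) (fun k => ?_) ?_ ?_ ?_
  · exact ((hmeas _).const_mul _).aestronglyMeasurable
  · refine ae_of_all _ fun t => ?_
    rw [hF, norm_mul, norm_div, norm_pow, norm_mul, norm_pow, norm_sq_add_I_mul]
    have : ‖(-m / 2 : ℂ)‖ = m / 2 := by
      rw [neg_div, norm_neg]
      simp [abs_of_pos hm]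
    rw [this]
    simp
  · exact ae_of_all _ fun t => (hbsum t).summable
  · simp_rw [fun t => (hbsum t).tsum_eq]
    refine (integrable_exp_add_abs_sub_sq
      (|b| * (m + m⁻¹) + m ^ 3 / 3 + m / 2 * m ^ 2) |b| (half_pos hm)).mono'
      ((hmeas b).norm.mul (by fun_prop)).aestronglyMeasurable (ae_of_all _ fun t => ?_)
    rw [norm_mul, norm_norm, Real.norm_eq_abs, Real.abs_exp]
    refine (mul_le_mul_of_nonneg_right (norm_airyKernel_vertical_le b hm t)
      (Real.exp_pos _).le).trans (le_of_eq ?_)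
    rw [← Real.exp_add]
    congr 1
    ring
  · refine ae_of_all _ fun t => ?_
    simp_rw [hF]
    have h := NormedSpace.expSeries_div_hasSum_exp (-m / 2 * ((m : ℂ) + Complex.I * t) ^ 2)
    rw [← Complex.exp_eq_exp_ℂ] at h
    exact h.mul_left _

/-- Integral representation of `Afun` along the vertical line through the saddle point. -/
theorem two_pi_mul_Afun_neg {y m : ℝ} (hy : ∀ n : ℕ, y ≠ n) (hm : 0 < m) :
    ((2 * π * Afun y (-m) : ℝ) : ℂ) = ∫ t : ℝ, ((m : ℂ) + Complex.I * t) ^ ((1 - y : ℝ) : ℂ) *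
      Complex.exp (-(m * t ^ 2 / 2) - Complex.I * (t ^ 3 / 3)) := by
  have hsum := hasSum_integral_airyKernel (1 - y) hm
  have hterm : ∀ k : ℕ, ((-m / 2) ^ k / k.factorial : ℝ) *
      ∫ t : ℝ, airyKernel (1 - y + 2 * k) (m + Complex.I * t) =
      ((2 * π * (3 : ℝ) ^ (-((y + 1) / 3)) *
        ((((3 : ℝ) ^ ((2 : ℝ) / 3) * (-m) / 2) ^ k / (k.factorial : ℝ)) *
          (Real.Gamma ((y + 1 - 2 * k) / 3))⁻¹) : ℝ) : ℂ) := by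
    intro k
    rw [integral_airyKernel_vertical (fun n hn => hy (2 + 2 * k + 3 * n)
      (by push_cast; linarith)) hm, ← Complex.ofReal_mul]
    congr 1
    have hp : (3 : ℝ) ^ ((1 - y + 2 * k - 2) / 3) =
        (3 : ℝ) ^ (-((y + 1) / 3)) * ((3 : ℝ) ^ ((2 : ℝ) / 3)) ^ k := by
      rw [← Real.rpow_natCast, ← Real.rpow_mul (by norm_num), ← Real.rpow_add (by norm_num)]
      congr 1
      ring
    rw [hp, show (2 - (1 - y + 2 * k)) / 3 = (y + 1 - 2 * k) / 3 by ring, mul_div_assoc, mul_pow]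
    ring
  simp_rw [hterm] at hsum
  have hA : ((2 * π * Afun y (-m) : ℝ) : ℂ) = Complex.exp ((m ^ 3 / 6 : ℝ) : ℂ) *
      ∫ t : ℝ, airyKernel (1 - y) (m + Complex.I * t) *
        Complex.exp (-m / 2 * ((m : ℂ) + Complex.I * t) ^ 2) := by
    rw [← hsum.tsum_eq, ← Complex.ofReal_tsum, tsum_mul_left, ← Complex.ofReal_exp,
      ← Complex.ofReal_mul, Afun]
    congr 1
    rw [show -(-m) ^ 3 / 6 = m ^ 3 / 6 by ring]
    ring
  rw [hA, ← integral_const_mul]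
  refine integral_congr_ae (ae_of_all _ fun t => ?_)
  simp only [airyKernel]
  rw [mul_comm, mul_assoc, mul_assoc, ← Complex.exp_add, ← Complex.exp_add]
  congr 2
  push_cast
  linear_combination ((t : ℂ) ^ 2 * m / 2 + Complex.I * t ^ 3 / 3) * Complex.I_sq

/-- The rescaled saddle point integral. -/
noncomputable def saddleIntegral (q e : ℝ) : ℂ :=
  ∫ u : ℝ, ((1 : ℂ) + Complex.I * (e * u : ℝ)) ^ (q : ℂ) *
    Complex.exp (-(u ^ 2 / 2) - Complex.I * (e * u ^ 3 / 3))

theorem tendsto_saddleIntegral (q : ℝ) :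
    Tendsto (saddleIntegral q) (𝓝 0) (𝓝 ((√(2 * π) : ℝ) : ℂ)) := by
  have hlim : ((√(2 * π) : ℝ) : ℂ) = ∫ u : ℝ, ((rexp (-(1 / 2) * u ^ 2) : ℝ) : ℂ) := by
    rw [integral_complex_ofReal, integral_gaussian]
    congr 2
    ring
  have he : ∀ᶠ e : ℝ in 𝓝 0, |e| ≤ 1 :=
    (continuous_abs.tendsto' (0 : ℝ) 0 abs_zero).eventually_le_const one_pos
  rw [hlim]
  refine tendsto_integral_filter_of_dominated_convergence
    (fun u : ℝ => rexp (|q| * 2 + |q| * |u| - 1 / 2 * u ^ 2))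
    (Eventually.of_forall fun e => by
      apply Measurable.aestronglyMeasurable
      fun_prop) ?_
    (integrable_exp_add_abs_sub_sq _ _ (by norm_num)) (ae_of_all _ fun u => ?_)
  · filter_upwards [he] with e he
    refine ae_of_all _ fun u => ?_
    have h1 := norm_cpow_ofReal_le_exp_of_le_norm q one_pos (le_norm_add_I_mul 1 (e * u))
    have h2 := norm_add_I_mul_le 1 (e * u) zero_le_one
    have h3 : |e * u| ≤ |u| := by
      rw [abs_mul]
      exact mul_le_of_le_one_left (abs_nonneg _) he
    rw [Complex.ofReal_one] at h1 h2
    have h4 : (-((u : ℂ) ^ 2 / 2) - Complex.I * (e * u ^ 3 / 3)).re = -(u ^ 2 / 2) := by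
      have : (-((u : ℂ) ^ 2 / 2) - Complex.I * (e * u ^ 3 / 3)) =
        ((-(u ^ 2 / 2) : ℝ) : ℂ) - Complex.I * ((e * u ^ 3 / 3 : ℝ) : ℂ) := by push_cast; rfl
      rw [this, Complex.sub_re, Complex.ofReal_re, Complex.I_mul_re, Complex.ofReal_im]
      ring
    rw [norm_mul, Complex.norm_exp, h4]
    calc _ ≤ rexp (|q| * (1 + |u| + 1⁻¹)) * rexp (-(u ^ 2 / 2)) := by
          gcongr
          refine h1.trans ?_
          gcongr
          linarith
      _ = _ := by rw [← Real.exp_add]; ring_nf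
  · have h1 : ContinuousAt (fun e : ℝ => ((1 : ℂ) + Complex.I * (e * u : ℝ)) ^ (q : ℂ) *
        Complex.exp (-(u ^ 2 / 2) - Complex.I * (e * u ^ 3 / 3))) 0 := by
      refine ContinuousAt.mul (ContinuousAt.cpow (by fun_prop) (by fun_prop) ?_) (by fun_prop)
      simp
    refine h1.tendsto.trans_eq ?_
    congr 1
    simp
    ring_nf

theorem two_pi_mul_Afun_neg_eq_saddleIntegral {y m : ℝ} (hy : ∀ n : ℕ, y ≠ n) (hm : 0 < m) :
    2 * π * Afun y (-m) =
      m ^ (1 / 2 - y) * (saddleIntegral (1 - y) (m ^ (-(3 / 2) : ℝ))).re := by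
  set a : ℝ := m ^ (-(1 / 2) : ℝ) with ha
  have ha0 : 0 < a := Real.rpow_pos_of_pos hm _
  have ha2 : m * a ^ 2 = 1 := by
    rw [ha, ← Real.rpow_natCast, ← Real.rpow_mul hm.le]
    norm_num [Real.rpow_neg_one, hm.ne']
  have ha3 : m ^ (-(3 / 2) : ℝ) = a ^ 3 := by
    rw [ha, ← Real.rpow_natCast, ← Real.rpow_mul hm.le]
    norm_num
  have hay : m ^ (1 / 2 - y) = a * m ^ (1 - y) := by
    rw [ha, ← Real.rpow_add hm]
    congr 1
    ring
  have hscale := Measure.integral_comp_mul_left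
    (fun t : ℝ => ((m : ℂ) + Complex.I * t) ^ ((1 - y : ℝ) : ℂ) *
      Complex.exp (-(m * t ^ 2 / 2) - Complex.I * (t ^ 3 / 3))) a
  rw [← two_pi_mul_Afun_neg hy hm] at hscale
  have hint : ∀ u : ℝ, ((m : ℂ) + Complex.I * (a * u : ℝ)) ^ ((1 - y : ℝ) : ℂ) *
      Complex.exp (-(m * (a * u : ℝ) ^ 2 / 2) - Complex.I * ((a * u : ℝ) ^ 3 / 3)) =
      ((m ^ (1 - y) : ℝ) : ℂ) * (((1 : ℂ) + Complex.I * (a ^ 3 * u : ℝ)) ^ ((1 - y : ℝ) : ℂ) *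
        Complex.exp (-(u ^ 2 / 2) - Complex.I * ((a ^ 3 : ℝ) * u ^ 3 / 3))) := by
    intro u
    have ha2c : (m : ℂ) * a ^ 2 = 1 := by exact_mod_cast ha2
    have hne : (1 : ℂ) + Complex.I * (a ^ 3 * u : ℝ) ≠ 0 := by
      have := add_I_mul_mem_slitPlane one_pos (a ^ 3 * u)
      rw [Complex.ofReal_one] at this
      exact Complex.slitPlane_ne_zero this
    have e1 : (m : ℂ) + Complex.I * (a * u : ℝ) =
        m * ((1 : ℂ) + Complex.I * (a ^ 3 * u : ℝ)) := by
      push_cast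
      linear_combination (-Complex.I * a * u) * ha2c
    rw [e1, ofReal_mul_cpow hm hne, Complex.ofReal_cpow hm.le, mul_assoc]
    congr 3
    push_cast
    linear_combination (-(u : ℂ) ^ 2 / 2) * ha2c
  simp_rw [hint] at hscale
  rw [integral_const_mul, ← saddleIntegral, ← ha3, Complex.real_smul, ← Complex.ofReal_mul] at hscale
  have hre := congrArg Complex.re hscale
  rw [Complex.re_ofReal_mul, Complex.ofReal_re, abs_of_pos (inv_pos.2 ha0)] at hre
  rw [hay, mul_assoc a, hre, mul_inv_cancel_left₀ ha0.ne']

end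

/-- For every fixed `r`, `√(2π) · |λ|^{3r} · A(3r + 1/2, λ) → 1` as `λ → -∞`. -/
theorem Afun_asymptotics (r : ℕ) :
    Tendsto (fun lam : ℝ =>
        Real.sqrt (2 * π) * |lam| ^ (3 * r) * Afun (3 * r + 1 / 2) lam)
      atBot (nhds 1) := by
  have hy : ∀ n : ℕ, (3 * r + 1 / 2 : ℝ) ≠ n := by
    intro n h
    have h2 : ((6 * r + 1 : ℕ) : ℝ) = ((2 * n : ℕ) : ℝ) := by push_cast; linarith
    have := Nat.cast_injective h2
    omega
  have hsqrt : √(2 * π) * √(2 * π) = 2 * π := Real.mul_self_sqrt (by positivity)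
  have hs0 : 0 < √(2 * π) := by positivity
  have hlim : Tendsto (fun lam : ℝ => (√(2 * π))⁻¹ *
      (saddleIntegral (1 - (3 * r + 1 / 2)) ((-lam) ^ (-(3 / 2) : ℝ))).re) atBot (nhds 1) := by
    have h1 : Tendsto (fun lam : ℝ => (-lam) ^ (-(3 / 2) : ℝ)) atBot (nhds 0) :=
      (tendsto_rpow_neg_atTop (by norm_num)).comp tendsto_neg_atBot_atTop
    have h2 := (Complex.continuous_re.tendsto _).comp
      ((tendsto_saddleIntegral (1 - (3 * r + 1 / 2))).comp h1)
    have h3 := h2.const_mul (√(2 * π))⁻¹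
    rwa [Complex.ofReal_re, inv_mul_cancel₀ hs0.ne'] at h3
  refine hlim.congr' ?_
  filter_upwards [eventually_lt_atBot 0] with lam hlam
  obtain ⟨m, rfl⟩ : ∃ m, lam = -m := ⟨-lam, by ring⟩
  have hm : 0 < m := by linarith
  have h := two_pi_mul_Afun_neg_eq_saddleIntegral hy hm
  have hp : m ^ (3 * r) * m ^ ((1 / 2 : ℝ) - (3 * r + 1 / 2)) = 1 := by
    rw [← Real.rpow_natCast, ← Real.rpow_add hm]
    push_cast
    ring_nf
    exact Real.rpow_zero m
  rw [abs_neg, abs_of_pos hm, neg_neg]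
  have h4 : (√(2 * π))⁻¹ * (2 * π) = √(2 * π) := by
    rw [inv_mul_eq_iff_eq_mul₀ hs0.ne', hsqrt]
  calc _ = (√(2 * π))⁻¹ * ((m ^ (3 * r) * m ^ ((1 / 2 : ℝ) - (3 * r + 1 / 2))) *
        (saddleIntegral (1 - (3 * r + 1 / 2)) (m ^ (-(3 / 2) : ℝ))).re) := by rw [hp, one_mul]
    _ = (√(2 * π))⁻¹ * (2 * π) * m ^ (3 * r) * Afun (3 * r + 1 / 2) (-m) := by
        rw [mul_assoc (m ^ (3 * r)), ← h]; ring
    _ = _ := by rw [h4]
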